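/- There is no continuously differentiable function w : (0,1) → ℝ with w(t) > 0 for all t ∈ (0,1) such that both of the following hold: (i) for every twice continuously differentiable function φ : (0,1) → ℝ with φ ≥ 0 and all 0 < s < t < 1, (φ(t)·w'(t) − φ'(t)·w(t)) − (φ(s)·w'(s) − φ'(s)·w(s)) ≥ −∫_s^t φ''(r)·w(r) dr + (3/4)·∫_s^t φ(r)·(w'(r))²/w(r) dr; and (ii) there is a constant C > 0 with w(t) ≤ C·min(t, 1 − t) for all t ∈ (0,1). -/

import Mathlib

/-- Nonexistence statement from the last theorem of Section 4 of the paper: there is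
no positive `C¹` function `w` on `(0,1)` satisfying the monotonicity inequality
against every nonnegative `C²` test function `φ` on `(0,1)` together with the
two-sided gradient estimate `w(t) ≤ C min(t, 1-t)`. -/
theorem stmt_9 :
    ¬ ∃ (w w' : ℝ → ℝ),
      (∀ t ∈ Set.Ioo (0:ℝ) 1, HasDerivAt w (w' t) t) ∧
      ContinuousOn w' (Set.Ioo (0:ℝ) 1) ∧
      (∀ t ∈ Set.Ioo (0:ℝ) 1, 0 < w t) ∧
      (∀ (φ φ' φ'' : ℝ → ℝ),
        (∀ r ∈ Set.Ioo (0:ℝ) 1, HasDerivAt φ (φ' r) r) →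
        (∀ r ∈ Set.Ioo (0:ℝ) 1, HasDerivAt φ' (φ'' r) r) →
        ContinuousOn φ'' (Set.Ioo (0:ℝ) 1) →
        (∀ r ∈ Set.Ioo (0:ℝ) 1, 0 ≤ φ r) →
        ∀ s t : ℝ, 0 < s → s < t → t < 1 →
          (φ t * w' t - φ' t * w t) - (φ s * w' s - φ' s * w s)
            ≥ -(∫ r in s..t, φ'' r * w r)
              + (3/4) * ∫ r in s..t, φ r * (w' r) ^ 2 / w r) ∧
      (∃ C > (0:ℝ), ∀ t ∈ Set.Ioo (0:ℝ) 1, w t ≤ C * min t (1 - t)) := by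
  rintro ⟨w, w', hw, -, hpos, hi, C, hC, hb⟩
  have ha : 0 < w (1/2) := hpos _ ⟨by norm_num, by norm_num⟩
  obtain ⟨e, he0, he1, he2⟩ : ∃ e : ℝ, 0 < e ∧ e < 1/2 ∧ C * e < w (1/2) := by
    refine ⟨min (1/4) (w (1/2) / (2 * C)), by positivity, ?_, ?_⟩
    · exact lt_of_le_of_lt (min_le_left _ _) (by norm_num)
    · have h1 : C * min (1/4) (w (1/2) / (2 * C)) ≤ C * (w (1/2) / (2 * C)) :=
        mul_le_mul_of_nonneg_left (min_le_right _ _) hC.le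
      have h2 : C * (w (1/2) / (2 * C)) = w (1/2) / 2 := by field_simp
      linarith
  have hwe : w e < w (1/2) := by
    have h1 := hb e ⟨he0, by linarith⟩
    have h2 := mul_le_mul_of_nonneg_left (min_le_left e (1 - e)) hC.le
    linarith
  have hwf : w (1 - e) < w (1/2) := by
    have h1 := hb (1 - e) ⟨by linarith, by linarith⟩
    have h2 := mul_le_mul_of_nonneg_left (min_le_right (1 - e) (1 - (1 - e))) hC.le
    have h3 : C * (1 - (1 - e)) = C * e := by ring
    linarith
  obtain ⟨c, hc, hc'⟩ := exists_hasDerivAt_eq_slope w w' he1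
    (fun x hx => (hw x ⟨by linarith [hx.1], by linarith [hx.2]⟩).continuousAt.continuousWithinAt)
    (fun x hx => hw x ⟨by linarith [hx.1], by linarith [hx.2]⟩)
  obtain ⟨d, hd, hd'⟩ := exists_hasDerivAt_eq_slope w w' (show (1/2 : ℝ) < 1 - e by linarith)
    (fun x hx => (hw x ⟨by linarith [hx.1], by linarith [hx.2]⟩).continuousAt.continuousWithinAt)
    (fun x hx => hw x ⟨by linarith [hx.1], by linarith [hx.2]⟩)
  have hcp : 0 < w' c := by
    rw [hc']; exact div_pos (by linarith) (by linarith)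
  have hdn : w' d < 0 := by
    rw [hd']; exact div_neg_of_neg_of_pos (by linarith) (by linarith)
  have hcd : c < d := hc.2.trans hd.1
  have key := hi (fun _ => 1) (fun _ => 0) (fun _ => 0)
    (fun r _ => hasDerivAt_const r 1) (fun r _ => hasDerivAt_const r 0)
    continuousOn_const (fun _ _ => zero_le_one) c d (by linarith [hc.1]) hcd (by linarith [hd.2])
  have hint : 0 ≤ ∫ r in c..d, (1:ℝ) * (w' r) ^ 2 / w r := by
    refine intervalIntegral.integral_nonneg hcd.le fun r hr => ?_
    have := hpos r ⟨by linarith [hr.1, hc.1], by linarith [hr.2, hd.2]⟩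
    positivity
  have hz : ∫ r in c..d, (0:ℝ) * w r = 0 := by simp
  simp only [hz] at key
  linarith
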